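/- If t₀ ∈ (0,1) satisfies Y(t₀) = 1, then −0.001491431277 < B₂(t₀) < −0.001491431155. -/

import Mathlib

noncomputable def h1 (t : ℝ) : ℝ := (2*t+1)/((3*t+1)*(1-t))

noncomputable def h2 (t : ℝ) : ℝ :=
  -(t^2*(1-t)*(5*t^2+36*t+18))/(2*(t+3)*(2*t+1)*(3*t+1)^2)

noncomputable def Y (t : ℝ) : ℝ := -1 + h1 t * Real.exp (h2 t)

noncomputable def B2 (t : ℝ) : ℝ :=
  (1-t)^3*(3*t-1)*(3*t+1)*(t+1)^3*Real.log (t+1)/(256*t^6)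
  - (1-t)^3*(3*t+1)*Real.log (3*t+1)/(32*t^3)
  + (3*t+1)^2*(1-t)^6*Real.log (2*t+1)/(512*t^6)
  + (t-1)^4*(185*t^4+698*t^3-217*t^2-160*t+6)/(1024*t^4*(3*t+1)*(t+3))

lemma aux_lt_log (x q : ℝ) (hx : 0 < x) (hq : 0 ≤ q)
    (h : (∑ i ∈ Finset.range 15, (q/2)^i/(Nat.factorial i : ℝ))^2 > x) : Real.log x < q := by
  rw [Real.log_lt_iff_lt_exp hx]
  have h1 := Real.sum_le_exp_of_nonneg (x := q/2) (by positivity) 15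
  have h2 : Real.exp q = Real.exp (q/2)^2 := by
    rw [← Real.exp_nat_mul]; congr 1; push_cast; ring
  rw [h2]
  refine lt_of_lt_of_le h ?_
  gcongr

lemma aux_log_lt (x q : ℝ) (hx : 0 < x) (hq : 0 ≤ q) (hq2 : q/2 ≤ 1)
    (h : ((∑ i ∈ Finset.range 15, (q/2)^i/(Nat.factorial i : ℝ)) +
      (q/2)^15 * (15+1)/((Nat.factorial 15 : ℝ)*15))^2 < x) : q < Real.log x := by
  rw [Real.lt_log_iff_exp_lt hx]
  have h1 := Real.exp_bound' (x := q/2) (by positivity) hq2 (n := 15) (by norm_num)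
  have h2 : Real.exp q = Real.exp (q/2)^2 := by
    rw [← Real.exp_nat_mul]; congr 1; push_cast; ring
  rw [h2]
  refine lt_of_le_of_lt ?_ h
  have := Real.exp_pos (q/2)
  push_cast at h1
  gcongr

noncomputable def gaux (t : ℝ) : ℝ :=
  Real.log (2*t+1) - Real.log (3*t+1) - Real.log (1-t) + h2 t

lemma gaux_mono : StrictMonoOn gaux (Set.Ioo 0 1) := by
  have key : ∀ t ∈ Set.Ioo (0:ℝ) 1, HasDerivAt gaux
      ((864*t^2+4416*t^3+7536*t^4+4794*t^5+846*t^6+6*t^7-30*t^8)/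
        (2*(t+3)^2*(2*t+1)^2*(3*t+1)^3*(1-t))) t := by
    rintro t ⟨h0, h1⟩
    have e1 : (2*t+1) ≠ 0 := by positivity
    have e2 : (3*t+1) ≠ 0 := by positivity
    have e3 : (1-t) ≠ 0 := by linarith
    have e4 : (t+3) ≠ 0 := by positivity
    have i := hasDerivAt_id' t
    have d1 := ((i.const_mul 2).add_const 1).log e1
    have d2 := ((i.const_mul 3).add_const 1).log e2
    have d3 := (i.const_sub 1).log e3
    have dn := (((i.pow 2).mul (i.const_sub 1)).mul
      ((((i.pow 2).const_mul 5).add (i.const_mul 36)).add_const 18)).neg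
    have dd := (((i.add_const 3).const_mul 2).mul ((i.const_mul 2).add_const 1)).mul
      (((i.const_mul 3).add_const 1).pow 2)
    have d4 := dn.div dd (by simp; exact ⟨⟨e4, e1⟩, e2⟩)
    have d := ((d1.sub d2).sub d3).add d4
    have dg : HasDerivAt gaux _ t := d
    refine dg.congr_deriv ?_
    simp only [Pi.mul_apply, Pi.neg_apply, Pi.add_apply, Pi.pow_apply]
    push_cast
    field_simp
    ring
  apply strictMonoOn_of_deriv_pos (convex_Ioo 0 1)
  · exact fun t ht => (key t ht).continuousAt.continuousWithinAt
  · intro t ht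
    rw [interior_Ioo] at ht
    rw [(key t ht).deriv]
    obtain ⟨h0, h1⟩ := ht
    have : 0 < 1 - t := by linarith
    have h8 : t^8 ≤ t^2 := pow_le_pow_of_le_one h0.le h1.le (by norm_num)
    have : 0 < 864*t^2+4416*t^3+7536*t^4+4794*t^5+846*t^6+6*t^7-30*t^8 := by
      have : 0 < 834*t^2+4416*t^3+7536*t^4+4794*t^5+846*t^6+6*t^7 := by positivity
      linarith
    positivity

lemma gaux_eq (t : ℝ) (h : t ∈ Set.Ioo (0:ℝ) 1) : gaux t = Real.log (h1 t) + h2 t := by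
  obtain ⟨h0, h1'⟩ := h
  have e3 : (1-t) ≠ 0 := by linarith
  have e1 : (2*t+1) ≠ 0 := by positivity
  have e2 : (3*t+1) ≠ 0 := by positivity
  unfold gaux h1
  rw [Real.log_div e1 (mul_ne_zero e2 e3), Real.log_mul e2 e3]
  ring

lemma gaux_root (t : ℝ) (h : t ∈ Set.Ioo (0:ℝ) 1) (hY : Y t = 1) : gaux t = Real.log 2 := by
  rw [gaux_eq t h]
  obtain ⟨h0, h1'⟩ := h
  have e3 : 0 < (1-t) := by linarith
  have hp : 0 < h1 t := by unfold h1; positivity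
  have : h1 t * Real.exp (h2 t) = 2 := by unfold Y at hY; linarith
  rw [← this, Real.log_mul hp.ne' (Real.exp_pos _).ne', Real.log_exp]

lemma gaux_a : gaux 0.626371663305 < Real.log 2 := by
  rw [gaux_eq _ (by constructor <;> norm_num)]
  have h := aux_lt_log (h1 0.626371663305 / 2) 0.0460123253050 (by unfold h1; norm_num)
    (by norm_num) (by
      unfold h1
      simp only [Finset.sum_range_succ, Finset.sum_range_zero, Nat.factorial]
      norm_num)
  rw [Real.log_div (by unfold h1; norm_num) (by norm_num)] at h
  have : h2 0.626371663305 < -0.0460123253050 := by unfold h2; norm_num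
  linarith

lemma gaux_b : Real.log 2 < gaux 0.626371663308 := by
  rw [gaux_eq _ (by constructor <;> norm_num)]
  have h := aux_log_lt (h1 0.626371663308 / 2) 0.0460123253080 (by unfold h1; norm_num)
    (by norm_num) (by norm_num) (by
      unfold h1
      simp only [Finset.sum_range_succ, Finset.sum_range_zero, Nat.factorial]
      norm_num)
  rw [Real.log_div (by unfold h1; norm_num) (by norm_num)] at h
  have : -0.0460123253080 < h2 0.626371663308 := by unfold h2; norm_num
  linarith

lemma la1 : 0.4863515602244 < Real.log (0.626371663305 + 1) := by
  apply aux_log_lt <;> (try simp only [Finset.sum_range_succ, Finset.sum_range_zero, Nat.factorial]) <;> norm_num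
lemma lb1 : Real.log (0.626371663308 + 1) < 0.4863515602267 := by
  apply aux_lt_log <;> (try simp only [Finset.sum_range_succ, Finset.sum_range_zero, Nat.factorial]) <;> norm_num
lemma la3 : 1.0574829517544 < Real.log (3*0.626371663305 + 1) := by
  apply aux_log_lt <;> (try simp only [Finset.sum_range_succ, Finset.sum_range_zero, Nat.factorial]) <;> norm_num
lemma lb3 : Real.log (3*0.626371663308 + 1) < 1.0574829517580 := by
  apply aux_lt_log <;> (try simp only [Finset.sum_range_succ, Finset.sum_range_zero, Nat.factorial]) <;> norm_num
lemma la2 : 0.8121487297979 < Real.log (2*0.626371663305 + 1) := by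
  apply aux_log_lt <;> (try simp only [Finset.sum_range_succ, Finset.sum_range_zero, Nat.factorial]) <;> norm_num
lemma lb2 : Real.log (2*0.626371663308 + 1) < 0.8121487298010 := by
  apply aux_lt_log <;> (try simp only [Finset.sum_range_succ, Finset.sum_range_zero, Nat.factorial]) <;> norm_num

lemma B2_bounds (a b t l1 l2 l3 u1 u2 u3 L1 L2 L3 : ℝ) (ha : 1/2 < a) (hat : a ≤ t) (htb : t ≤ b)
    (hb : b < 1) (p1 : 0 < l1) (p2 : 0 < l2) (p3 : 0 < l3)
    (hl1 : l1 ≤ L1) (hl2 : l2 ≤ L2) (hl3 : l3 ≤ L3)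
    (hu1 : L1 ≤ u1) (hu2 : L2 ≤ u2) (hu3 : L3 ≤ u3)
    (hP : 0 < 185*a^4+698*a^3-217*b^2-160*b+6) :
    ((1-b)^3*(3*a-1)*(3*a+1)*(a+1)^3*l1/(256*b^6)
      - (1-a)^3*(3*b+1)*u3/(32*a^3)
      + (3*a+1)^2*(1-b)^6*l2/(512*b^6)
      + (1-b)^4*(185*a^4+698*a^3-217*b^2-160*b+6)/(1024*b^4*(3*b+1)*(b+3)) ≤
    (1-t)^3*(3*t-1)*(3*t+1)*(t+1)^3*L1/(256*t^6)
      - (1-t)^3*(3*t+1)*L3/(32*t^3)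
      + (3*t+1)^2*(1-t)^6*L2/(512*t^6)
      + (t-1)^4*(185*t^4+698*t^3-217*t^2-160*t+6)/(1024*t^4*(3*t+1)*(t+3))) ∧
    ((1-t)^3*(3*t-1)*(3*t+1)*(t+1)^3*L1/(256*t^6)
      - (1-t)^3*(3*t+1)*L3/(32*t^3)
      + (3*t+1)^2*(1-t)^6*L2/(512*t^6)
      + (t-1)^4*(185*t^4+698*t^3-217*t^2-160*t+6)/(1024*t^4*(3*t+1)*(t+3)) ≤
    (1-a)^3*(3*b-1)*(3*b+1)*(b+1)^3*u1/(256*a^6)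
      - (1-b)^3*(3*a+1)*l3/(32*b^3)
      + (3*b+1)^2*(1-a)^6*u2/(512*a^6)
      + (1-a)^4*(185*b^4+698*b^3-217*a^2-160*a+6)/(1024*a^4*(3*a+1)*(a+3))) := by
  have e : (t-1)^4 = (1-t)^4 := by ring
  rw [e]
  have a0 : 0 < a := by linarith
  have t0 : 0 < t := by linarith
  have b0 : 0 < b := by linarith
  have b1 : 0 < 1 - b := by linarith
  have t1 : 0 < 1 - t := by linarith
  have a1 : 0 < 1 - a := by linarith
  have a3 : 0 < 3*a - 1 := by linarith
  have t3 : 0 < 3*t - 1 := by linarith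
  have b3 : 0 < 3*b - 1 := by linarith
  have q1 : 0 < L1 := by linarith
  have q2 : 0 < L2 := by linarith
  have q3 : 0 < L3 := by linarith
  have r1 : 0 < u1 := by linarith
  have r2 : 0 < u2 := by linarith
  have r3 : 0 < u3 := by linarith
  have P1 : 185*a^4+698*a^3-217*b^2-160*b+6 ≤ 185*t^4+698*t^3-217*t^2-160*t+6 := by gcongr
  have P2 : 185*t^4+698*t^3-217*t^2-160*t+6 ≤ 185*b^4+698*b^3-217*a^2-160*a+6 := by gcongr
  have Pt := hP.trans_le P1
  have Pb := Pt.trans_le P2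
  generalize 185*a^4+698*a^3-217*b^2-160*b+6 = X1 at *
  generalize 185*t^4+698*t^3-217*t^2-160*t+6 = X2 at *
  generalize 185*b^4+698*b^3-217*a^2-160*a+6 = X3 at *
  constructor
  · gcongr
  · gcongr

theorem B2_at_t0 : ∀ t₀ : ℝ, t₀ ∈ Set.Ioo (0:ℝ) 1 → Y t₀ = 1 →
    -0.001491431277 < B2 t₀ ∧ B2 t₀ < -0.001491431155 := by
  intro t ht hY
  have hr := gaux_root t ht hY
  have hat : 0.626371663305 ≤ t := by
    by_contra! h
    have := gaux_mono ht (by constructor <;> norm_num) h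
    linarith [gaux_a]
  have htb : t ≤ 0.626371663308 := by
    by_contra! h
    have := gaux_mono (by constructor <;> norm_num) ht h
    linarith [gaux_b]
  have t0 := ht.1
  have m1 : Real.log (0.626371663305 + 1) ≤ Real.log (t+1) := by gcongr
  have m2 : Real.log (2*0.626371663305 + 1) ≤ Real.log (2*t+1) := by gcongr
  have m3 : Real.log (3*0.626371663305 + 1) ≤ Real.log (3*t+1) := by gcongr
  have n1 : Real.log (t+1) ≤ Real.log (0.626371663308 + 1) := by gcongr
  have n2 : Real.log (2*t+1) ≤ Real.log (2*0.626371663308 + 1) := by gcongr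
  have n3 : Real.log (3*t+1) ≤ Real.log (3*0.626371663308 + 1) := by gcongr
  obtain ⟨hA, hB⟩ := B2_bounds _ _ t _ _ _ _ _ _ _ _ _ (by norm_num) hat htb (by norm_num)
    (by norm_num) (by norm_num) (by norm_num) (la1.le.trans m1) (la2.le.trans m2) (la3.le.trans m3)
    (n1.trans lb1.le) (n2.trans lb2.le) (n3.trans lb3.le) (by norm_num)
  unfold B2
  constructor
  · refine lt_of_lt_of_le ?_ hA
    norm_num
  · refine lt_of_le_of_lt hB ?_
    norm_num
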